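/- Let {s_1,...,s_K} be an (M,K,L)-schedule sequence set with respect to a partition of the K nodes into W nonempty groups whose smallest group size is k ≥ 1. Then L ≥ ⌈(8(k−1)²·W·(1 − 1/k))/9⌉. -/

import Mathlib

/-- A schedule symbol for a system with `W` channels: `T m` means "transmit on
channel `m`" and `R r` means "receive on channel `r`". -/
inductive SchedSym (W : ℕ) where
  | T : Fin W → SchedSym W
  | R : Fin W → SchedSym W
deriving DecidableEq

/-- `IsScheduleSet W K L G s` says that `s` is an `(M,K,L)`-schedule sequence set
(for any number of channels `M ≥ W`) with respect to the partition of the `K` nodes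
into the `W` groups given by the group-assignment map `G` (node `i` lies in group
`G i`). Sequences are modeled as `ℕ → SchedSym W`, indexed modulo `L`.

* `own_channel`: a node in group `m` only uses the transmit symbol `T m`;
* `intra`: intra-group requirement (eq. (1) of the paper) for all offsets `τ ∈ Z_L^K`;
* `inter`: inter-group requirement (eq. (2) of the paper) for all offsets `τ ∈ Z_L^K`. -/
structure IsScheduleSet (W K L : ℕ) (G : Fin K → Fin W)
    (s : Fin K → ℕ → SchedSym W) : Prop where
  own_channel : ∀ (i : Fin K) (t : ℕ) (m : Fin W), s i t = SchedSym.T m → m = G i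
  intra : ∀ τ : Fin K → ℕ, (∀ i, τ i < L) → ∀ i j : Fin K, i ≠ j → G i = G j →
    ∃ t < L, s i ((t + τ i) % L) = SchedSym.T (G i) ∧
      s j ((t + τ j) % L) = SchedSym.R (G i) ∧
      ∀ x : Fin K, x ≠ i → x ≠ j → G x = G i → s x ((t + τ x) % L) ≠ SchedSym.T (G i)
  inter : ∀ τ : Fin K → ℕ, (∀ i, τ i < L) → ∀ i j : Fin K, G i ≠ G j →
    ∃ t < L, s i ((t + τ i) % L) = SchedSym.T (G i) ∧
      s j ((t + τ j) % L) = SchedSym.R (G i) ∧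
      ∀ x : Fin K, x ≠ i → G x = G i → s x ((t + τ x) % L) ≠ SchedSym.T (G i)

/-- The size of group `m` under the group-assignment map `G`. -/
def groupSize {W K : ℕ} (G : Fin K → Fin W) (m : Fin W) : ℕ :=
  (Finset.univ.filter (fun i => G i = m)).card

open Finset

/-- Over all cyclic shifts, each point of `S` meets each `u < L` satisfying `p` exactly once. -/
lemma sum_card_filter_shift (L : ℕ) (p : ℕ → Prop) [DecidablePred p] (S : Finset ℕ) :
    ∑ τ ∈ range L, #{t ∈ S | p ((t + τ) % L)} = #S * #{u ∈ range L | p u} := by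
  have hrow : ∀ t, #{τ ∈ range L | p ((t + τ) % L)} = #{u ∈ range L | p u} := by
    intro t
    have hper : Function.Periodic (fun u => p (u % L)) L := by
      intro u; simp
    have h1 := Nat.filter_Ico_card_eq_of_periodic t L (fun u => p (u % L)) hper
    have h2 := Nat.filter_Ico_card_eq_of_periodic 0 L (fun u => p (u % L)) hper
    have h3 : #{u ∈ range L | p u} = #{u ∈ Ico 0 (0 + L) | p (u % L)} := by
      rw [zero_add, ← Finset.range_eq_Ico]
      congr 1
      refine filter_congr fun u hu => ?_
      rw [Nat.mod_eq_of_lt (mem_range.1 hu)]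
    rw [h3, h2, ← h1]
    refine card_bij (fun τ _ => t + τ) ?_ ?_ ?_
    · intro τ hτ
      simp only [mem_filter, mem_range, mem_Ico] at hτ ⊢
      exact ⟨by omega, hτ.2⟩
    · intro a _ b _ h
      simpa using h
    · intro u hu
      simp only [mem_filter, mem_Ico] at hu
      refine ⟨u - t, ?_, by omega⟩
      simp only [mem_filter, mem_range]
      exact ⟨by omega, by rw [Nat.add_sub_cancel' hu.1.1]; exact hu.2⟩
  have hswap := sum_card_bipartiteAbove_eq_sum_card_bipartiteBelow
    (s := range L) (t := S) (fun τ t => p ((t + τ) % L))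
  simp only [bipartiteAbove, bipartiteBelow] at hswap
  rw [hswap, sum_congr rfl fun t _ => hrow t, sum_const, smul_eq_mul]

/-- Some shift meets `S` in at least the average number of points. -/
lemma exists_shift_card_ge (L : ℕ) (hL : 0 < L) (p : ℕ → Prop) [DecidablePred p]
    (S : Finset ℕ) :
    ∃ τ < L, #S * #{u ∈ range L | p u} ≤ L * #{t ∈ S | p ((t + τ) % L)} := by
  by_contra! h
  have := sum_lt_sum_of_nonempty (s := range L) ⟨0, mem_range.2 hL⟩
    fun τ hτ => h τ (mem_range.1 hτ)
  simp only [← mul_sum, sum_card_filter_shift, sum_const, card_range, smul_eq_mul] at this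
  exact this.ne (by ring)

/-- Some shift meets `S` in at most the average number of points. -/
lemma exists_shift_card_le (L : ℕ) (hL : 0 < L) (p : ℕ → Prop) [DecidablePred p]
    (S : Finset ℕ) :
    ∃ τ < L, L * #{t ∈ S | p ((t + τ) % L)} ≤ #S * #{u ∈ range L | p u} := by
  by_contra! h
  have := sum_lt_sum_of_nonempty (s := range L) ⟨0, mem_range.2 hL⟩
    fun τ hτ => h τ (mem_range.1 hτ)
  simp only [← mul_sum, sum_card_filter_shift, sum_const, card_range, smul_eq_mul] at this
  exact this.ne (by ring)

/-- The `c`-th harmonic number, as a real number. -/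
noncomputable def realHarmonic (c : ℕ) : ℝ := ∑ i ∈ range c, 1 / ((i : ℝ) + 1)

lemma realHarmonic_zero : realHarmonic 0 = 0 := by simp [realHarmonic]

lemma realHarmonic_succ (c : ℕ) :
    realHarmonic (c + 1) = realHarmonic c + 1 / ((c : ℝ) + 1) := by
  simp [realHarmonic, sum_range_succ]

/-- The line through `(c ρ, ρ H_c)` of slope `1 / (c + 1)`. The lower envelope over `c` of these
lines bounds the number of greedy covering steps. -/
noncomputable def coverLine (ρ : ℝ) (c : ℕ) (n : ℝ) : ℝ :=
  ρ * realHarmonic c + (n - c * ρ) / ((c : ℝ) + 1)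

lemma coverLine_le_succ {ρ n : ℝ} {c : ℕ} (h : n ≤ (c + 1) * ρ) :
    coverLine ρ c n ≤ coverLine ρ (c + 1) n := by
  have key : coverLine ρ (c + 1) n - coverLine ρ c n
      = ((c + 1) * ρ - n) / (((c : ℝ) + 1) * (c + 2)) := by
    simp only [coverLine, realHarmonic_succ]
    push_cast
    field_simp
    ring
  have : 0 ≤ ((c + 1) * ρ - n) / (((c : ℝ) + 1) * (c + 2)) :=
    div_nonneg (by linarith) (by positivity)
  linarith

lemma coverLine_zero_nonneg {ρ : ℝ} (hρ : 0 ≤ ρ) (c : ℕ) : 0 ≤ coverLine ρ c 0 := by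
  induction c with
  | zero => simp [coverLine, realHarmonic_zero]
  | succ c ih => exact ih.trans (coverLine_le_succ (by positivity))

/-- Removing `d ≥ n / ρ` elements out of `n` lowers the envelope of the lines by at least one. -/
lemma add_one_le_coverLine {ρ a n n' : ℝ} {d : ℕ} (hρ : 0 < ρ) (hd : 1 ≤ d)
    (hnd : n ≤ d * ρ) (hn : n' + d ≤ n) (h : ∀ c, a ≤ coverLine ρ c n') (c : ℕ) :
    a + 1 ≤ coverLine ρ c n := by
  have main : ∀ c : ℕ, c + 1 ≤ d → a + 1 ≤ coverLine ρ c n := by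
    intro c hc
    have hc' : (c : ℝ) + 1 ≤ d := by exact_mod_cast hc
    have hpos : (0 : ℝ) < (c : ℝ) + 1 := by positivity
    have hdiff : coverLine ρ c n - coverLine ρ c n' = (n - n') / ((c : ℝ) + 1) := by
      simp only [coverLine]; field_simp; ring
    have : 1 ≤ (n - n') / ((c : ℝ) + 1) := by
      rw [le_div_iff₀ hpos]; linarith
    linarith [h c]
  induction c with
  | zero => exact main 0 (by omega)
  | succ c ih =>
    by_cases hc : n ≤ ((c : ℝ) + 1) * ρ
    · exact ih.trans (coverLine_le_succ hc)
    · push Not at hc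
      have : ((c : ℝ) + 1) < d := lt_of_mul_lt_mul_right (hc.trans_le hnd) hρ.le
      exact main (c + 1) (by exact_mod_cast this)

lemma realHarmonic_bounds {c : ℕ} (hc : 2 ≤ c) :
    realHarmonic c ≤ (2 * c + 5) / 6 ∧ realHarmonic c ^ 2 ≤ 9 / 8 * c ∧
      2 * realHarmonic c / (c + 1) + 1 / ((c : ℝ) + 1) ^ 2 ≤ 9 / 8 := by
  have slope : ∀ c : ℕ, 2 ≤ c → realHarmonic c ≤ (2 * c + 5) / 6 →
      2 * realHarmonic c / (c + 1) + 1 / ((c : ℝ) + 1) ^ 2 ≤ 9 / 8 := by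
    intro c hc h
    have hc' : (2 : ℝ) ≤ c := by exact_mod_cast hc
    have hpos : (0 : ℝ) < (c : ℝ) + 1 := by positivity
    have : 2 * realHarmonic c / (c + 1) + 1 / ((c : ℝ) + 1) ^ 2
        = (2 * realHarmonic c * (c + 1) + 1) / ((c : ℝ) + 1) ^ 2 := by
      field_simp
    rw [this, div_le_iff₀ (by positivity)]
    nlinarith [mul_le_mul_of_nonneg_right h hpos.le]
  induction c, hc using Nat.le_induction with
  | base =>
    have h2 : realHarmonic 2 = 3 / 2 := by
      norm_num [realHarmonic, sum_range_succ]
    rw [h2]; norm_num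
  | succ c hc ih =>
    obtain ⟨h1, h2, h3⟩ := ih
    have hc' : (2 : ℝ) ≤ c := by exact_mod_cast hc
    have hb : realHarmonic (c + 1) ≤ (2 * ((c + 1 : ℕ) : ℝ) + 5) / 6 := by
      rw [realHarmonic_succ]
      have : 1 / ((c : ℝ) + 1) ≤ 1 / 3 :=
        one_div_le_one_div_of_le (by norm_num) (by linarith)
      push_cast
      linarith
    refine ⟨hb, ?_, by simpa using slope (c + 1) (by omega) hb⟩
    rw [realHarmonic_succ]
    have : (realHarmonic c + 1 / ((c : ℝ) + 1)) ^ 2 = realHarmonic c ^ 2 +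
        (2 * realHarmonic c / (c + 1) + 1 / ((c : ℝ) + 1) ^ 2) := by
      field_simp
      ring
    rw [this]
    push_cast
    linarith

lemma sq_harmonic_interpolation_le (c : ℕ) {θ : ℝ} (h0 : 0 ≤ θ) (h1 : θ ≤ 1) :
    (realHarmonic c + θ / ((c : ℝ) + 1)) ^ 2 ≤ 9 / 8 * (c + θ) := by
  rcases Nat.lt_or_ge c 2 with hc | hc
  · interval_cases c
    · simp only [realHarmonic_zero]
      norm_num
      nlinarith
    · norm_num [realHarmonic]
      nlinarith [mul_nonneg h0 (sub_nonneg.2 h1)]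
  · obtain ⟨-, h2, h3⟩ := realHarmonic_bounds hc
    have hsq : θ ^ 2 * (1 / ((c : ℝ) + 1) ^ 2) ≤ θ * (1 / ((c : ℝ) + 1) ^ 2) :=
      mul_le_mul_of_nonneg_right (by nlinarith) (by positivity)
    have : (realHarmonic c + θ / ((c : ℝ) + 1)) ^ 2 = realHarmonic c ^ 2 +
        θ * (2 * realHarmonic c / (c + 1)) + θ ^ 2 * (1 / ((c : ℝ) + 1) ^ 2) := by
      field_simp
      ring
    nlinarith [mul_le_mul_of_nonneg_left h3 h0]

lemma sq_le_of_forall_le_coverLine {ρ a n : ℝ} (hρ : 0 < ρ) (ha : 0 ≤ a) (hn : 0 ≤ n)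
    (h : ∀ c, a ≤ coverLine ρ c n) : a ^ 2 ≤ 9 / 8 * (ρ * n) := by
  set c := ⌊n / ρ⌋₊
  have h1 : (c : ℝ) ≤ n / ρ := Nat.floor_le (by positivity)
  have h2 : n / ρ < c + 1 := Nat.lt_floor_add_one _
  have hI := sq_harmonic_interpolation_le c (θ := n / ρ - c) (by linarith) (by linarith)
  have hline : coverLine ρ c n = ρ * (realHarmonic c + (n / ρ - c) / ((c : ℝ) + 1)) := by
    simp only [coverLine]
    field_simp
  calc a ^ 2 ≤ (coverLine ρ c n) ^ 2 := pow_le_pow_left₀ ha (h c) 2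
    _ = ρ ^ 2 * (realHarmonic c + (n / ρ - c) / ((c : ℝ) + 1)) ^ 2 := by rw [hline]; ring
    _ ≤ ρ ^ 2 * (9 / 8 * (c + (n / ρ - c))) := by gcongr
    _ = 9 / 8 * (ρ * n) := by field_simp; ring

/-- If no choice of cyclic shifts of the sets `A x`, `x ∈ X`, each of size at least `w`, covers
`S`, then `|X| + 1` lies below every covering line at `|S|`. -/
lemma card_add_one_le_coverLine {ι : Type*} [DecidableEq ι] {L w : ℕ}
    (hw : 0 < w) (hwL : w ≤ L) (A : ι → ℕ → Prop) [∀ x, DecidablePred (A x)] (X : Finset ι)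
    (hA : ∀ x ∈ X, w ≤ #{u ∈ range L | A x u}) (S : Finset ℕ)
    (h : ∀ τ : ι → ℕ, (∀ x, τ x < L) → ∃ t ∈ S, ∀ x ∈ X, ¬ A x ((t + τ x) % L)) (c : ℕ) :
    (#X : ℝ) + 1 ≤ coverLine ((L : ℝ) / w) c #S := by
  have hL : 0 < L := hw.trans_le hwL
  have hwR : (0 : ℝ) < w := by exact_mod_cast hw
  have hLR : (0 : ℝ) < L := by exact_mod_cast hL
  have hρ : (0 : ℝ) < (L : ℝ) / w := by positivity
  have hSpos : ∀ {Y : Finset ι} {S : Finset ℕ}, (∀ τ : ι → ℕ, (∀ x, τ x < L) →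
      ∃ t ∈ S, ∀ x ∈ Y, ¬ A x ((t + τ x) % L)) → 0 < #S := fun h => by
    obtain ⟨t, ht, -⟩ := h (fun _ => 0) fun _ => hL
    exact card_pos.2 ⟨t, ht⟩
  induction X using Finset.induction_on generalizing S c with
  | empty =>
    have hρ1 : (1 : ℝ) ≤ (L : ℝ) / w := by
      rw [le_div_iff₀ hwR, one_mul]; exact_mod_cast hwL
    have := add_one_le_coverLine (a := 0) (n := #S) (n' := 0) (d := #S) hρ
      (hSpos h) (le_mul_of_one_le_right (by positivity) hρ1) (by simp)
      (coverLine_zero_nonneg hρ.le) c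
    simpa using this
  | insert x X hx ih =>
    obtain ⟨σ, hσ, hσS⟩ := exists_shift_card_ge L hL (A x) S
    have hsplit := card_filter_add_card_filter_not (s := S) (fun t => A x ((t + σ) % L))
    set d := #{t ∈ S | A x ((t + σ) % L)}
    have hwd : #S * w ≤ L * d :=
      (Nat.mul_le_mul_left _ (hA x (mem_insert_self x X))).trans hσS
    have hd : 1 ≤ d := by
      by_contra! hd0
      have : 0 < #S * w := Nat.mul_pos (hSpos h) hw
      simp only [Nat.lt_one_iff.1 hd0] at hwd
      omega
    have hrest := ih (fun y hy => hA y (mem_insert_of_mem hy))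
      {t ∈ S | ¬ A x ((t + σ) % L)} (by
        intro τ hτ
        obtain ⟨t, ht, hcov⟩ := h (Function.update τ x σ) (by
          intro y
          by_cases hy : y = x
          · subst hy; simpa using hσ
          · simpa [hy] using hτ y)
        refine ⟨t, ?_, ?_⟩
        · have := hcov x (mem_insert_self x X)
          simp only [Function.update_self] at this
          exact mem_filter.2 ⟨ht, this⟩
        · intro y hy
          have hyx : y ≠ x := fun hyx => hx (hyx ▸ hy)
          simpa [hyx] using hcov y (mem_insert_of_mem hy))
    rw [card_insert_of_notMem hx]
    push_cast
    refine add_one_le_coverLine hρ hd ?_ ?_ hrest c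
    · rw [← mul_div_assoc, le_div_iff₀ hwR]
      have : (#S : ℝ) * w ≤ L * d := by exact_mod_cast hwd
      linarith
    · have : (d : ℝ) + (#{t ∈ S | ¬ A x ((t + σ) % L)} : ℝ) = #S := by exact_mod_cast hsplit
      linarith

/-- Every node must listen to every channel for at least `8 (k - 1)² / 9` slots per period. -/
lemma IsScheduleSet.card_receive_ge {W K L : ℕ} {G : Fin K → Fin W} {s : Fin K → ℕ → SchedSym W}
    (hs : IsScheduleSet W K L G s) (hL : 0 < L) {k : ℕ} (hk : 2 ≤ k) (j : Fin K) (m : Fin W)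
    (hm : k ≤ groupSize G m) :
    8 * ((k : ℝ) - 1) ^ 2 ≤ 9 * (#{u ∈ range L | s j u = SchedSym.R m} : ℝ) := by
  have hcard : k ≤ #{i | G i = m} := hm
  have herase := pred_card_le_card_erase (s := ({i | G i = m} : Finset (Fin K))) (a := j)
  set Y := ({i | G i = m} : Finset (Fin K)).erase j with hY
  have hYne : Y.Nonempty := card_pos.1 (by omega)
  obtain ⟨i, hiY, hmin⟩ := exists_min_image Y
    (fun x => #{u ∈ range L | s x u = SchedSym.T m}) hYne
  have hij : i ≠ j := (mem_erase.1 hiY).1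
  have hGi : G i = m := (mem_filter.1 (mem_erase.1 hiY).2).2
  have hunblocked : ∀ τ : Fin K → ℕ, (∀ x, τ x < L) → ∃ t < L,
      s i ((t + τ i) % L) = SchedSym.T m ∧ s j ((t + τ j) % L) = SchedSym.R m ∧
      ∀ x ∈ Y.erase i, s x ((t + τ x) % L) ≠ SchedSym.T m := by
    intro τ hτ
    by_cases hGj : G j = m
    · obtain ⟨t, ht, h1, h2, h3⟩ := hs.intra τ hτ i j hij (hGi.trans hGj.symm)
      rw [hGi] at h1 h2 h3
      refine ⟨t, ht, h1, h2, fun x hx => ?_⟩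
      simp only [hY, mem_erase, mem_filter, mem_univ, true_and] at hx
      exact h3 x hx.1 hx.2.1 hx.2.2
    · obtain ⟨t, ht, h1, h2, h3⟩ := hs.inter τ hτ i j fun h => hGj (h.symm.trans hGi)
      rw [hGi] at h1 h2 h3
      refine ⟨t, ht, h1, h2, fun x hx => ?_⟩
      simp only [hY, mem_erase, mem_filter, mem_univ, true_and] at hx
      exact h3 x hx.1 hx.2.2
  set w := #{u ∈ range L | s i u = SchedSym.T m}
  set B := ({u ∈ range L | s j u = SchedSym.R m} : Finset ℕ)
  have hwpos : 0 < w := by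
    obtain ⟨t, -, h1, -⟩ := hunblocked (fun _ => 0) fun _ => hL
    exact card_pos.2 ⟨_, mem_filter.2 ⟨mem_range.2 (Nat.mod_lt _ hL), h1⟩⟩
  have hwL : w ≤ L := (card_filter_le _ _).trans (card_range L).le
  obtain ⟨σ, hσ, hσB⟩ := exists_shift_card_le L hL (fun u => s i u = SchedSym.T m) B
  set S := ({t ∈ B | s i ((t + σ) % L) = SchedSym.T m} : Finset ℕ)
  have hcover := card_add_one_le_coverLine hwpos hwL (fun x u => s x u = SchedSym.T m)
    (Y.erase i) (fun x hx => hmin x (mem_of_mem_erase hx)) S (by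
      intro τ hτ
      obtain ⟨t, ht, h1, h2, h3⟩ :=
        hunblocked (Function.update (Function.update τ j 0) i σ) (by
          intro x
          simp only [Function.update_apply]
          split_ifs
          exacts [hσ, hL, hτ x])
      simp only [Function.update_self, Function.update_of_ne hij.symm, add_zero,
        Nat.mod_eq_of_lt ht] at h1 h2
      refine ⟨t, mem_filter.2 ⟨mem_filter.2 ⟨mem_range.2 ht, h2⟩, h1⟩, fun x hx => ?_⟩
      have hxi : x ≠ i := (mem_erase.1 hx).1
      have hxj : x ≠ j := (mem_erase.1 (mem_erase.1 hx).2).1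
      simpa [Function.update_of_ne hxi, Function.update_of_ne hxj] using h3 x hx)
  have hwR : (0 : ℝ) < w := by exact_mod_cast hwpos
  have hLR : (0 : ℝ) < L := by exact_mod_cast hL
  have hsq := sq_le_of_forall_le_coverLine (by positivity) (by positivity) (by positivity) hcover
  have hX : (k : ℝ) - 1 ≤ (#(Y.erase i) : ℝ) + 1 := by
    have : k ≤ #(Y.erase i) + 2 := by
      rw [card_erase_of_mem hiY]; omega
    have : (k : ℝ) ≤ (#(Y.erase i) : ℝ) + 2 := by exact_mod_cast this
    linarith
  have hk1 : (0 : ℝ) ≤ (k : ℝ) - 1 := by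
    have : (2 : ℝ) ≤ k := by exact_mod_cast hk
    linarith
  have hSB : (L : ℝ) / w * #S ≤ #B := by
    rw [div_mul_eq_mul_div, div_le_iff₀ hwR]
    exact_mod_cast hσB
  have := pow_le_pow_left₀ hk1 hX 2
  linarith

lemma sum_card_receive_le {W : ℕ} (L : ℕ) (f : ℕ → SchedSym W) :
    ∑ m, #{u ∈ range L | f u = SchedSym.R m} ≤ L := by
  rw [← card_biUnion]
  · exact (card_le_card (biUnion_subset.2 fun m _ => filter_subset _ _)).trans (card_range L).le
  · intro m _ n _ hmn
    refine disjoint_filter.2 fun u _ h1 h2 => hmn ?_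
    simpa using h1.symm.trans h2

/-- if `{s_1,...,s_K}` is an `(M,K,L)`-schedule sequence set with
respect to a partition into `W` nonempty groups with smallest group size `k ≥ 1`, then
`L ≥ ⌈8(k−1)²·W·(1 − 1/k)/9⌉`. -/
theorem schedule_set_period_lower_bound
    (M K L W k : ℕ) (hL : 0 < L) (hW : 1 ≤ W) (hWM : W ≤ M) (hMK : M ≤ K)
    (hk : 1 ≤ k)
    (G : Fin K → Fin W) (hG : Function.Surjective G)
    (hkmin : ∀ m : Fin W, k ≤ groupSize G m)
    (hkex : ∃ m : Fin W, groupSize G m = k)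
    (s : Fin K → ℕ → SchedSym W) (hs : IsScheduleSet W K L G s) :
    ⌈(8 * ((k : ℝ) - 1) ^ 2 * (W : ℝ) * (1 - 1 / (k : ℝ))) / 9⌉ ≤ (L : ℤ) := by
  rw [Int.ceil_le, Int.cast_natCast]
  rcases hk.eq_or_lt with rfl | hk2
  · simp
  obtain ⟨j, -⟩ := hG ⟨0, hW⟩
  have hsum : ∑ _m : Fin W, 8 * ((k : ℝ) - 1) ^ 2 ≤
      ∑ m : Fin W, 9 * (#{u ∈ range L | s j u = SchedSym.R m} : ℝ) :=
    sum_le_sum fun m _ => hs.card_receive_ge hL hk2 j m (hkmin m)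
  have hle : ∑ m : Fin W, (#{u ∈ range L | s j u = SchedSym.R m} : ℝ) ≤ L := by
    exact_mod_cast sum_card_receive_le L (s j)
  rw [← mul_sum univ _ (9 : ℝ), sum_const, card_univ, Fintype.card_fin, nsmul_eq_mul] at hsum
  have hfac : 1 - 1 / (k : ℝ) ≤ 1 := by
    have : (0 : ℝ) ≤ 1 / k := by positivity
    linarith
  have hnonneg : (0 : ℝ) ≤ 8 * ((k : ℝ) - 1) ^ 2 * W := by positivity
  have := mul_le_of_le_one_right hnonneg hfac
  linarith
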